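/- Let V be a finite-dimensional real vector space, Q a quadratic form on V, and T₁, T₂ : V → V two commuting linear involutions (T₁ ∘ T₁ = id, T₂ ∘ T₂ = id, T₁ ∘ T₂ = T₂ ∘ T₁), each satisfying Q(Tᵢ x) = Q(x) for all x ∈ V. For signs ε₁, ε₂ ∈ {+1, −1}, let V^{ε₁ ε₂} = {x ∈ V : T₁ x = ε₁ x and T₂ x = ε₂ x}. For a subspace W ⊆ V, define the negative index of Q on W as the largest dimension of a subspace U ⊆ W on which Q is negative definite (i.e. Q(x) < 0 for all nonzero x ∈ U). Then the negative index of Q on V equals the sum of the negative indices of Q on the four joint eigenspaces V^{++}, V^{+−}, V^{−+}, V^{−−}. -/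

import Mathlib

/-- The negative index of a quadratic form `Q` on a subspace `W`: the largest dimension of
a subspace `U ⊆ W` on which `Q` is negative definite. -/
noncomputable def negIndex {V : Type*} [AddCommGroup V] [Module ℝ V]
    (Q : QuadraticForm ℝ V) (W : Submodule ℝ V) : ℕ :=
  sSup {n : ℕ | ∃ U : Submodule ℝ V, U ≤ W ∧ (∀ x ∈ U, x ≠ 0 → Q x < 0) ∧
    Module.finrank ℝ U = n}

section NegIndex

variable {V : Type*} [AddCommGroup V] [Module ℝ V] {Q : QuadraticForm ℝ V}

open Module QuadraticMap

lemma negDef_sup {A B : Submodule ℝ V} (hA : ∀ x ∈ A, x ≠ 0 → Q x < 0)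
    (hB : ∀ x ∈ B, x ≠ 0 → Q x < 0) (hAB : ∀ a ∈ A, ∀ b ∈ B, Q.IsOrtho a b) :
    ∀ x ∈ A ⊔ B, x ≠ 0 → Q x < 0 := by
  intro x hx hx0
  obtain ⟨a, ha, b, hb, rfl⟩ := Submodule.mem_sup.1 hx
  rw [isOrtho_def.1 (hAB a ha b hb)]
  by_cases ha0 : a = 0
  · have hb0 : b ≠ 0 := by simpa [ha0] using hx0
    simpa [ha0] using hB b hb hb0
  · by_cases hb0 : b = 0
    · simpa [hb0] using hA a ha ha0
    · exact add_neg (hA a ha ha0) (hB b hb hb0)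

variable [FiniteDimensional ℝ V]

lemma negIndex_isGreatest (Q : QuadraticForm ℝ V) (W : Submodule ℝ V) :
    IsGreatest {n : ℕ | ∃ U : Submodule ℝ V, U ≤ W ∧ (∀ x ∈ U, x ≠ 0 → Q x < 0) ∧
      finrank ℝ U = n} (negIndex Q W) := by
  have hbdd : BddAbove {n : ℕ | ∃ U : Submodule ℝ V, U ≤ W ∧ (∀ x ∈ U, x ≠ 0 → Q x < 0) ∧
      finrank ℝ U = n} := by
    refine ⟨finrank ℝ V, ?_⟩
    rintro _ ⟨U, -, -, rfl⟩
    exact U.finrank_le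
  refine ⟨Nat.sSup_mem ⟨0, ⊥, bot_le, ?_, finrank_bot ℝ V⟩ hbdd, fun n hn ↦ le_csSup hbdd hn⟩
  intro x hx hx0
  exact absurd ((Submodule.mem_bot ℝ).1 hx) hx0

lemma negIndex_eq_finrank_of_nonneg_compl {U N W : Submodule ℝ V} (hUW : U ≤ W) (hNW : N ≤ W)
    (hU : ∀ x ∈ U, x ≠ 0 → Q x < 0) (hN : ∀ x ∈ N, 0 ≤ Q x)
    (hdim : finrank ℝ U + finrank ℝ N = finrank ℝ W) : negIndex Q W = finrank ℝ U := by
  refine (negIndex_isGreatest Q W).unique ⟨⟨U, hUW, hU, rfl⟩, ?_⟩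
  rintro _ ⟨U', hU'W, hU', rfl⟩
  have hdisj : Disjoint U' N := by
    rw [Submodule.disjoint_def]
    intro x hx hxN
    by_contra hx0
    exact (hU' x hx hx0).not_ge (hN x hxN)
  have h := Submodule.finrank_sup_add_finrank_inf_eq U' N
  rw [hdisj.eq_bot, finrank_bot, add_zero] at h
  have := Submodule.finrank_mono (sup_le hU'W hNW)
  omega

lemma isCompl_orthogonal_of_negDef {U : Submodule ℝ V} (hU : ∀ x ∈ U, x ≠ 0 → Q x < 0) :
    IsCompl U (LinearMap.BilinForm.orthogonal Q.polarBilin U) := by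
  have hrefl : LinearMap.BilinForm.IsRefl Q.polarBilin := by
    intro x y h
    rw [polarBilin_apply_apply] at h ⊢
    rwa [polar_comm]
  rw [LinearMap.BilinForm.isCompl_orthogonal_iff_disjoint hrefl, Submodule.disjoint_def]
  intro x hx hx'
  by_contra hx0
  have h : polar Q x x = 0 := hx' x hx
  rw [polar_self, smul_eq_zero] at h
  exact (hU x hx hx0).ne (h.resolve_left two_ne_zero)

lemma exists_negDef_sup_nonneg (Q : QuadraticForm ℝ V) (W : Submodule ℝ V) :
    ∃ U N : Submodule ℝ V, U ⊔ N = W ∧ Disjoint U N ∧ (∀ x ∈ U, x ≠ 0 → Q x < 0) ∧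
      (∀ x ∈ N, 0 ≤ Q x) ∧ finrank ℝ U = negIndex Q W := by
  obtain ⟨⟨U, hUW, hU, hdim⟩, hmax⟩ := negIndex_isGreatest Q W
  have hc := isCompl_orthogonal_of_negDef hU
  refine ⟨U, LinearMap.BilinForm.orthogonal Q.polarBilin U ⊓ W, ?_,
    hc.disjoint.mono_right inf_le_left, hU, ?_, hdim⟩
  · rw [← sup_inf_assoc_of_le _ hUW, hc.sup_eq_top, top_inf_eq]
  · rintro x ⟨hxU, hxW⟩
    by_contra! hx
    have hx0 : x ≠ 0 := by
      rintro rfl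
      simp at hx
    have hspan : ∀ y ∈ Submodule.span ℝ {x}, y ≠ 0 → Q y < 0 := by
      intro y hy hy0
      obtain ⟨c, rfl⟩ := Submodule.mem_span_singleton.1 hy
      rw [QuadraticMap.map_smul, smul_eq_mul]
      exact mul_neg_of_pos_of_neg (mul_self_pos.2 (left_ne_zero_of_smul hy0)) hx
    have hxle : Submodule.span ℝ {x} ≤ LinearMap.BilinForm.orthogonal Q.polarBilin U :=
      (Submodule.span_singleton_le_iff_mem _ _).2 hxU
    have hneg := negDef_sup hU hspan fun a ha b hb ↦ isOrtho_polarBilin.1 (hxle hb a ha)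
    have hle := hmax ⟨_, sup_le hUW ((Submodule.span_singleton_le_iff_mem _ _).2 hxW), hneg, rfl⟩
    have h := Submodule.finrank_sup_add_finrank_inf_eq U (Submodule.span ℝ {x})
    rw [(hc.disjoint.mono_right hxle).eq_bot, finrank_bot, finrank_span_singleton hx0] at h
    omega

lemma negIndex_sup {A B : Submodule ℝ V} (hdisj : Disjoint A B)
    (hAB : ∀ a ∈ A, ∀ b ∈ B, Q.IsOrtho a b) :
    negIndex Q (A ⊔ B) = negIndex Q A + negIndex Q B := by
  have finrank_sup {C D : Submodule ℝ V} (h : Disjoint C D) :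
      finrank ℝ ↥(C ⊔ D) = finrank ℝ C + finrank ℝ D := by
    rw [← Submodule.finrank_sup_add_finrank_inf_eq, h.eq_bot, finrank_bot, add_zero]
  obtain ⟨U, N, rfl, hd, hU, hN, hdim⟩ := exists_negDef_sup_nonneg Q A
  obtain ⟨U', N', rfl, hd', hU', hN', hdim'⟩ := exists_negDef_sup_nonneg Q B
  have hUU' : Disjoint U U' := hdisj.mono le_sup_left le_sup_left
  have hNN' : Disjoint N N' := hdisj.mono le_sup_right le_sup_right
  rw [← hdim, ← hdim', ← finrank_sup hUU']
  refine negIndex_eq_finrank_of_nonneg_compl (N := N ⊔ N') (sup_le_sup le_sup_left le_sup_left)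
    (sup_le_sup le_sup_right le_sup_right) (negDef_sup hU hU' fun a ha b hb ↦
      hAB a (Submodule.mem_sup_left ha) b (Submodule.mem_sup_left hb)) ?_ ?_
  · intro x hx
    obtain ⟨a, ha, b, hb, rfl⟩ := Submodule.mem_sup.1 hx
    rw [isOrtho_def.1 (hAB a (Submodule.mem_sup_right ha) b (Submodule.mem_sup_right hb))]
    exact add_nonneg (hN a ha) (hN' b hb)
  · rw [finrank_sup hUU', finrank_sup hNN', finrank_sup hdisj, finrank_sup hd, finrank_sup hd']
    omega

lemma negIndex_sup_of_isometry {T : V →ₗ[ℝ] V} (hQT : ∀ x, Q (T x) = Q x)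
    {A B : Submodule ℝ V} (hA : ∀ x ∈ A, T x = x) (hB : ∀ x ∈ B, T x = -x) :
    negIndex Q (A ⊔ B) = negIndex Q A + negIndex Q B := by
  refine negIndex_sup ?_ fun a ha b hb ↦ ?_
  · rw [Submodule.disjoint_def]
    intro x hxA hxB
    have := IsAddTorsionFree.of_isTorsionFree ℝ V
    exact self_eq_neg.1 ((hA x hxA).symm.trans (hB x hxB))
  · have h : polar Q (T a) (T b) = polar Q a b := by
      simp only [polar, ← map_add, hQT]
    rw [hA a ha, hB b hb, polar_neg_right] at h
    exact isOrtho_polarBilin.1 (self_eq_neg.1 h.symm)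

end NegIndex

/-- If `T₁, T₂` are commuting linear involutions of a finite-dimensional real vector space
`V`, each preserving a quadratic form `Q`, then the negative index of `Q` on `V` is the sum
of the negative indices of `Q` on the four joint eigenspaces `V^{±±}`. -/
theorem negIndex_decomp_two_involutions (V : Type*) [AddCommGroup V] [Module ℝ V]
    [FiniteDimensional ℝ V]
    (Q : QuadraticForm ℝ V) (T₁ T₂ : V →ₗ[ℝ] V)
    (hT₁ : T₁ ∘ₗ T₁ = LinearMap.id) (hT₂ : T₂ ∘ₗ T₂ = LinearMap.id)
    (hcomm : T₁ ∘ₗ T₂ = T₂ ∘ₗ T₁)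
    (hQT₁ : ∀ x : V, Q (T₁ x) = Q x) (hQT₂ : ∀ x : V, Q (T₂ x) = Q x)
    (Vpp Vpm Vmp Vmm : Submodule ℝ V)
    (hVpp : ∀ x : V, x ∈ Vpp ↔ T₁ x = x ∧ T₂ x = x)
    (hVpm : ∀ x : V, x ∈ Vpm ↔ T₁ x = x ∧ T₂ x = -x)
    (hVmp : ∀ x : V, x ∈ Vmp ↔ T₁ x = -x ∧ T₂ x = x)
    (hVmm : ∀ x : V, x ∈ Vmm ↔ T₁ x = -x ∧ T₂ x = -x) :
    negIndex Q ⊤ = negIndex Q Vpp + negIndex Q Vpm + negIndex Q Vmp + negIndex Q Vmm := by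
  have hT₁' (x : V) : T₁ (T₁ x) = x := LinearMap.congr_fun hT₁ x
  have hT₂' (x : V) : T₂ (T₂ x) = x := LinearMap.congr_fun hT₂ x
  have hcomm' (x : V) : T₁ (T₂ x) = T₂ (T₁ x) := LinearMap.congr_fun hcomm x
  have htop : (Vpp ⊔ Vpm) ⊔ (Vmp ⊔ Vmm) = ⊤ := by
    rw [eq_top_iff]
    intro x _
    have hx : x = (((1 / 4 : ℝ) • (x + T₁ x + T₂ x + T₂ (T₁ x))) +
        ((1 / 4 : ℝ) • (x + T₁ x - T₂ x - T₂ (T₁ x)))) +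
        (((1 / 4 : ℝ) • (x - T₁ x + T₂ x - T₂ (T₁ x))) +
        ((1 / 4 : ℝ) • (x - T₁ x - T₂ x + T₂ (T₁ x)))) := by
      module
    rw [hx]
    refine Submodule.add_mem_sup (Submodule.add_mem_sup ?_ ?_) (Submodule.add_mem_sup ?_ ?_)
    · rw [hVpp]
      constructor <;> simp only [map_smul, map_add, hcomm', hT₁', hT₂'] <;> module
    · rw [hVpm]
      constructor <;> simp only [map_smul, map_add, map_sub, hcomm', hT₁', hT₂'] <;> module
    · rw [hVmp]
      constructor <;> simp only [map_smul, map_add, map_sub, hcomm', hT₁', hT₂'] <;> module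
    · rw [hVmm]
      constructor <;> simp only [map_smul, map_add, map_sub, hcomm', hT₁', hT₂'] <;> module
  have hfix : Vpp ⊔ Vpm ≤ LinearMap.eqLocus T₁ LinearMap.id :=
    sup_le (fun x hx ↦ ((hVpp x).1 hx).1) fun x hx ↦ ((hVpm x).1 hx).1
  have hneg : Vmp ⊔ Vmm ≤ LinearMap.eqLocus T₁ (-LinearMap.id) :=
    sup_le (fun x hx ↦ ((hVmp x).1 hx).1) fun x hx ↦ ((hVmm x).1 hx).1
  rw [← htop, negIndex_sup_of_isometry hQT₁ (fun x hx ↦ hfix hx) (fun x hx ↦ hneg hx),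
    negIndex_sup_of_isometry hQT₂ (fun x hx ↦ ((hVpp x).1 hx).2) (fun x hx ↦ ((hVpm x).1 hx).2),
    negIndex_sup_of_isometry hQT₂ (fun x hx ↦ ((hVmp x).1 hx).2) (fun x hx ↦ ((hVmm x).1 hx).2),
    ← add_assoc]
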